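/- arXiv:2504.10718 — 4 statements merged into one kernel-verified Lean document; each statement's English description precedes it below -/
import Mathlib

section
/- Let G₊ and G₋ be the Euclidean and Lorentzian ADM metric matrices built from shared data (N, Nᵃ, ĝ). Then both G₊ and G₋ are invertible and G₋ G₊⁻¹ G₋ = G₊; equivalently, for the inverse matrices, G₋⁻¹ G₊ G₋⁻¹ = G₊⁻¹. -/
open Matrix
open scoped BigOperators

theorem Matrix.IsSymm.two_mul_dotProduct_mulVec {n : Type*} [Fintype n] {A : Matrix n n ℝ}
    (hA : A.IsSymm) (u v : n → ℝ) :
    2 * (u ⬝ᵥ A *ᵥ v) = (u + v) ⬝ᵥ A *ᵥ (u + v) - u ⬝ᵥ A *ᵥ u - v ⬝ᵥ A *ᵥ v := by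
  have h : v ⬝ᵥ A *ᵥ u = u ⬝ᵥ A *ᵥ v := by
    rw [dotProduct_mulVec, ← mulVec_transpose, hA.eq, dotProduct_comm]
  simp only [mulVec_add, dotProduct_add, add_dotProduct, h]
  ring

theorem Matrix.IsSymm.ext_of_dotProduct_mulVec {n : Type*} [Fintype n] [DecidableEq n]
    {A B : Matrix n n ℝ} (hA : A.IsSymm) (hB : B.IsSymm)
    (h : ∀ v : n → ℝ, v ⬝ᵥ A *ᵥ v = v ⬝ᵥ B *ᵥ v) : A = B := by
  ext i j
  have key := hA.two_mul_dotProduct_mulVec (Pi.single i 1) (Pi.single j 1)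
  rw [h, h, h, ← hB.two_mul_dotProduct_mulVec] at key
  simpa using key

theorem sum_sum_mul_mul_eq_dotProduct_mulVec {n : Type*} [Fintype n] (A : Matrix n n ℝ)
    (x : n → ℝ) : ∑ a, ∑ b, A a b * x a * x b = x ⬝ᵥ A *ᵥ x := by
  simp only [dotProduct, mulVec, Finset.mul_sum]
  exact Finset.sum_congr rfl fun a _ => Finset.sum_congr rfl fun b _ => by ring

theorem mul_inv_mul_of_involutive {n : Type*} [Fintype n] [DecidableEq n]
    {A R : Matrix n n ℝ} (hA : IsUnit A) (hR : R * R = 1) :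
    IsUnit (A * R) ∧ A * R * A⁻¹ * (A * R) = A ∧ (A * R)⁻¹ * A * (A * R)⁻¹ = A⁻¹ := by
  have hdet : IsUnit A.det := (isUnit_iff_isUnit_det A).1 hA
  refine ⟨hA.mul (IsUnit.of_mul_eq_one R hR), ?_, ?_⟩
  · rw [Matrix.mul_assoc (A * R), nonsing_inv_mul_cancel_left _ _ hdet, Matrix.mul_assoc, hR,
      Matrix.mul_one]
  · rw [Matrix.mul_inv_rev, inv_eq_left_inv hR, Matrix.mul_assoc R, nonsing_inv_mul _ hdet,
      Matrix.mul_one, ← Matrix.mul_assoc, hR, Matrix.one_mul]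

/-- The Euclidean and Lorentzian ADM metric matrices `G₊`, `G₋` built from shared data
`(N, Nᵃ, ĝ)` (characterized as symmetric matrices by their quadratic forms) are both
invertible and satisfy `G₋ G₊⁻¹ G₋ = G₊`, equivalently `G₋⁻¹ G₊ G₋⁻¹ = G₊⁻¹`. -/
theorem adm_matrices_invertible_and_intertwine
    (d : ℕ) (N : ℝ) (hN : 0 < N) (Ns : Fin d → ℝ)
    (g : Matrix (Fin d) (Fin d) ℝ) (hg : g.PosDef)
    (Gp Gm : Matrix (Fin (d + 1)) (Fin (d + 1)) ℝ)
    (hGpSymm : Gp.IsSymm) (hGmSymm : Gm.IsSymm)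
    (hGp : ∀ v : Fin (d + 1) → ℝ, v ⬝ᵥ Gp.mulVec v =
      N ^ 2 * (v 0) ^ 2 +
        ∑ a, ∑ b, g a b * (v a.succ + Ns a * v 0) * (v b.succ + Ns b * v 0))
    (hGm : ∀ v : Fin (d + 1) → ℝ, v ⬝ᵥ Gm.mulVec v =
      -(N ^ 2) * (v 0) ^ 2 +
        ∑ a, ∑ b, g a b * (v a.succ + Ns a * v 0) * (v b.succ + Ns b * v 0)) :
    IsUnit Gp ∧ IsUnit Gm ∧ Gm * Gp⁻¹ * Gm = Gp ∧ Gm⁻¹ * Gp * Gm⁻¹ = Gp⁻¹ := by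
  have hpos : Gp.PosDef := by
    refine PosDef.of_dotProduct_mulVec_pos (by simpa [IsHermitian] using hGpSymm.eq) fun v hv => ?_
    rw [star_trivial, hGp,
      sum_sum_mul_mul_eq_dotProduct_mulVec g fun a => v a.succ + Ns a * v 0]
    by_cases h0 : v 0 = 0
    · have hx : (fun a => v a.succ + Ns a * v 0) ≠ 0 := fun hx => hv <| by
        ext i
        refine Fin.cases h0 (fun a => ?_) i
        simpa [h0] using congrFun hx a
      have := hg.dotProduct_mulVec_pos hx
      rw [star_trivial] at this
      positivity
    · have := hg.posSemidef.dotProduct_mulVec_nonneg fun a => v a.succ + Ns a * v 0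
      rw [star_trivial] at this
      positivity
  set e : Fin (d + 1) → ℝ := Pi.single 0 1 with he
  set u : Fin (d + 1) → ℝ := Fin.cons 1 (-Ns) with hu
  have hu0 : u 0 = 1 := rfl
  have hus : ∀ a : Fin d, u a.succ = -Ns a := fun _ => rfl
  have hGpu : Gp *ᵥ u = N ^ 2 • e := by
    refine dotProduct_eq _ _ fun w => ?_
    have key := hGpSymm.two_mul_dotProduct_mulVec w u
    have hshift : ∀ a : Fin d, (w + u) a.succ + Ns a * (w + u) 0 = w a.succ + Ns a * w 0 := by
      intro a
      simp only [Pi.add_apply, hu0, hus]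
      ring
    simp only [hGp, hshift] at key
    simp only [hus, hu0, Pi.add_apply, mul_one, neg_add_cancel, mul_zero,
      Finset.sum_const_zero] at key
    rw [dotProduct_comm, smul_dotProduct, he, single_one_dotProduct, smul_eq_mul]
    linarith
  have hGmEq : Gm = Gp * (1 - (2 : ℝ) • vecMulVec u e) := by
    have hR : Gp * (1 - (2 : ℝ) • vecMulVec u e) = Gp - (2 * N ^ 2) • vecMulVec e e := by
      rw [Matrix.mul_sub, Matrix.mul_one, Matrix.mul_smul, mul_vecMulVec, hGpu, smul_vecMulVec,
        smul_smul]
    rw [hR]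
    refine hGmSymm.ext_of_dotProduct_mulVec
      (hGpSymm.sub (IsSymm.smul (transpose_vecMulVec e e) _)) fun v => ?_
    rw [sub_mulVec, dotProduct_sub, hGm, hGp, smul_mulVec, vecMulVec_mulVec]
    simp only [he, dotProduct_smul, single_one_dotProduct, dotProduct_single_one, smul_eq_mul,
      MulOpposite.smul_eq_mul_unop, MulOpposite.unop_op]
    ring
  have hinv : (1 - (2 : ℝ) • vecMulVec u e) * (1 - (2 : ℝ) • vecMulVec u e) = 1 := by
    have hidem : vecMulVec u e * vecMulVec u e = vecMulVec u e := by
      rw [vecMulVec_mul_vecMulVec, he, single_one_dotProduct, hu0, one_smul]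
    simp only [Matrix.mul_sub, Matrix.sub_mul, Matrix.mul_one, Matrix.one_mul, Matrix.mul_smul,
      Matrix.smul_mul, hidem]
    module
  rw [hGmEq]
  exact ⟨hpos.isUnit, mul_inv_mul_of_involutive hpos.isUnit hinv⟩
end

section
/- Let θ ∈ ℝ and let G_θ and G₊ be the lapse-Wick-rotated and Euclidean ADM matrices built from shared data (N, Nᵃ, ĝ). Then for every ξ ∈ ℂ^{1+d}: Re(−i e^{iθ} · Σ_{μ,ν} (G_θ)_{μν} ξ^μ (ξ^ν)*) = sin θ · Σ_{μ,ν} (G₊)_{μν} ξ^μ (ξ^ν)*. In particular, for θ ∈ (0, π) the left-hand side is strictly positive whenever ξ ≠ 0. -/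
open Matrix Complex
open scoped BigOperators ComplexConjugate

/-- For a symmetric complex matrix, the sesquilinear evaluation at `ξ` is the sum of the quadratic
form evaluated at the real and at the imaginary part of `ξ`. -/
theorem Matrix.IsSymm.sum_mul_mul_conj {n : Type*} [Fintype n] {M : Matrix n n ℂ}
    (hM : M.IsSymm) (ξ : n → ℂ) :
    ∑ μ, ∑ ν, M μ ν * ξ μ * conj (ξ ν) =
      (fun μ => ((ξ μ).re : ℂ)) ⬝ᵥ M *ᵥ (fun μ => ((ξ μ).re : ℂ)) +
        (fun μ => ((ξ μ).im : ℂ)) ⬝ᵥ M *ᵥ (fun μ => ((ξ μ).im : ℂ)) := by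
  have hcross : ∑ μ, ∑ ν, M μ ν * (ξ μ).im * (ξ ν).re = ∑ μ, ∑ ν, M μ ν * (ξ μ).re * (ξ ν).im := by
    rw [Finset.sum_comm]
    refine Finset.sum_congr rfl fun μ _ => Finset.sum_congr rfl fun ν _ => ?_
    rw [hM.apply μ ν]
    ring
  have hterm : ∀ μ ν, M μ ν * ξ μ * conj (ξ ν) =
      (ξ μ).re * (M μ ν * (ξ ν).re) + (ξ μ).im * (M μ ν * (ξ ν).im) +
        I * (M μ ν * (ξ μ).im * (ξ ν).re - M μ ν * (ξ μ).re * (ξ ν).im) := by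
    intro μ ν
    have hconj : conj (ξ ν) = (ξ ν).re - (ξ ν).im * I := by
      apply Complex.ext <;> simp
    rw [hconj]
    conv_lhs => rw [← re_add_im (ξ μ)]
    linear_combination (-M μ ν * (ξ μ).im * (ξ ν).im) * I_sq
  simp only [hterm, Finset.sum_add_distrib, ← Finset.mul_sum, Finset.sum_sub_distrib, hcross,
    sub_self, mul_zero, add_zero, dotProduct, mulVec]

/-- The real version of `Matrix.IsSymm.sum_mul_mul_conj`. -/
theorem Matrix.IsSymm.re_sum_ofReal_mul_mul_conj {n : Type*} [Fintype n] {M : Matrix n n ℝ}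
    (hM : M.IsSymm) (ξ : n → ℂ) :
    (∑ μ, ∑ ν, (M μ ν : ℂ) * ξ μ * conj (ξ ν)).re =
      (fun μ => (ξ μ).re) ⬝ᵥ M *ᵥ (fun μ => (ξ μ).re) +
        (fun μ => (ξ μ).im) ⬝ᵥ M *ᵥ (fun μ => (ξ μ).im) := by
  have h := (hM.map ((↑) : ℝ → ℂ)).sum_mul_mul_conj ξ
  simp only [map_apply] at h
  rw [h, ← ofReal_re (_ + _)]
  simp [dotProduct, mulVec]

/-- Rotating the real quadratic value `-e^{-2iθ} a + b` by `-i e^{iθ}` gives a number with real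
part `sin θ (a + b)`. -/
theorem re_neg_I_mul_exp_mul_wick (θ a b : ℝ) :
    (-I * exp (θ * I) * (-exp (-2 * θ * I) * a + b)).re = Real.sin θ * (a + b) := by
  have hexp : exp (θ * I) * exp (-2 * θ * I) = exp ((-θ : ℝ) * I) := by
    rw [← exp_add]
    congr 1
    push_cast
    ring
  have h : -I * exp (θ * I) * (-exp (-2 * θ * I) * a + b) =
      I * exp ((-θ : ℝ) * I) * a - I * exp (θ * I) * b := by
    linear_combination I * a * hexp
  rw [h]
  simp only [sub_re, mul_assoc, I_mul_re, im_mul_ofReal, exp_ofReal_mul_I_im, Real.sin_neg]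
  ring

/-- The Euclidean ADM quadratic form is positive definite. -/
theorem euclideanADM_pos {d : ℕ} {N : ℝ} (hN : 0 < N) (Ns : Fin d → ℝ)
    {g : Matrix (Fin d) (Fin d) ℝ} (hg : g.PosDef) {v : Fin (d + 1) → ℝ} (hv : v ≠ 0) :
    0 < N ^ 2 * (v 0) ^ 2 +
      ∑ a, ∑ b, g a b * (v a.succ + Ns a * v 0) * (v b.succ + Ns b * v 0) := by
  set w : Fin d → ℝ := fun a => v a.succ + Ns a * v 0 with hw
  have hsum : ∑ a, ∑ b, g a b * (v a.succ + Ns a * v 0) * (v b.succ + Ns b * v 0) =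
      star w ⬝ᵥ g *ᵥ w := by
    simp only [dotProduct, mulVec, Finset.mul_sum, star_trivial, hw]
    exact Finset.sum_congr rfl fun a _ => Finset.sum_congr rfl fun b _ => by ring
  rw [hsum]
  by_cases h0 : v 0 = 0
  · have hw0 : w ≠ 0 := by
      refine fun h => hv (funext fun μ => ?_)
      refine Fin.cases h0 (fun a => ?_) μ
      simpa [hw, h0] using congrFun h a
    have := hg.dotProduct_mulVec_pos hw0
    positivity
  · have := hg.posSemidef.dotProduct_mulVec_nonneg w
    positivity

/-- For the lapse-Wick-rotated ADM matrix `G_θ` and the Euclidean ADM matrix `G₊` built from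
shared data `(N, Nᵃ, ĝ)`, one has, for every `ξ ∈ ℂ^{1+d}`,
`Re(-i e^{iθ} Σ (G_θ)_{μν} ξ^μ (ξ^ν)*) = sin θ · Σ (G₊)_{μν} ξ^μ (ξ^ν)*`; in particular, for
`θ ∈ (0,π)` the left-hand side is strictly positive whenever `ξ ≠ 0`. -/
theorem wick_rotated_sesquilinear_real_part
    (d : ℕ) (θ : ℝ) (N : ℝ) (hN : 0 < N) (Ns : Fin d → ℝ)
    (g : Matrix (Fin d) (Fin d) ℝ) (hg : g.PosDef)
    (Gp : Matrix (Fin (d + 1)) (Fin (d + 1)) ℝ)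
    (Gθ : Matrix (Fin (d + 1)) (Fin (d + 1)) ℂ)
    (hGpSymm : Gp.IsSymm) (hGθSymm : Gθ.IsSymm)
    (hGp : ∀ v : Fin (d + 1) → ℝ, v ⬝ᵥ Gp.mulVec v =
      N ^ 2 * (v 0) ^ 2 +
        ∑ a, ∑ b, g a b * (v a.succ + Ns a * v 0) * (v b.succ + Ns b * v 0))
    (hGθ : ∀ v : Fin (d + 1) → ℂ, v ⬝ᵥ Gθ.mulVec v =
      -Complex.exp (-2 * (θ : ℂ) * Complex.I) * (N : ℂ) ^ 2 * (v 0) ^ 2 +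
        ∑ a, ∑ b, ((g a b : ℝ) : ℂ) * (v a.succ + (Ns a : ℂ) * v 0) *
          (v b.succ + (Ns b : ℂ) * v 0)) :
    ∀ ξ : Fin (d + 1) → ℂ,
      (-Complex.I * Complex.exp ((θ : ℂ) * Complex.I) *
          ∑ μ, ∑ ν, Gθ μ ν * ξ μ * conj (ξ ν)).re =
        Real.sin θ * (∑ μ, ∑ ν, ((Gp μ ν : ℝ) : ℂ) * ξ μ * conj (ξ ν)).re ∧
      (θ ∈ Set.Ioo 0 Real.pi → ξ ≠ 0 →
        0 < (-Complex.I * Complex.exp ((θ : ℂ) * Complex.I) *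
          ∑ μ, ∑ ν, Gθ μ ν * ξ μ * conj (ξ ν)).re) := by
  intro ξ
  have hreal : ∀ v : Fin (d + 1) → ℝ,
      (-I * exp (θ * I) * ((fun μ => (v μ : ℂ)) ⬝ᵥ Gθ *ᵥ (fun μ => (v μ : ℂ)))).re =
        Real.sin θ * (v ⬝ᵥ Gp *ᵥ v) := by
    intro v
    rw [hGθ, hGp, ← re_neg_I_mul_exp_mul_wick]
    push_cast
    simp only [mul_assoc]
  have hre : (-I * exp (θ * I) * ∑ μ, ∑ ν, Gθ μ ν * ξ μ * conj (ξ ν)).re =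
      Real.sin θ * (∑ μ, ∑ ν, (Gp μ ν : ℂ) * ξ μ * conj (ξ ν)).re := by
    rw [hGθSymm.sum_mul_mul_conj, hGpSymm.re_sum_ofReal_mul_mul_conj, mul_add, add_re,
      hreal (fun μ => (ξ μ).re), hreal (fun μ => (ξ μ).im), mul_add]
  refine ⟨hre, fun hθ hξ => ?_⟩
  rw [hre, hGpSymm.re_sum_ofReal_mul_mul_conj]
  refine mul_pos (Real.sin_pos_of_mem_Ioo hθ) ?_
  have hpos : ∀ v : Fin (d + 1) → ℝ, v ≠ 0 → 0 < v ⬝ᵥ Gp *ᵥ v := fun v hv => by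
    rw [hGp]
    exact euclideanADM_pos hN Ns hg hv
  have hnonneg : ∀ v : Fin (d + 1) → ℝ, 0 ≤ v ⬝ᵥ Gp *ᵥ v := fun v => by
    rcases eq_or_ne v 0 with rfl | hv
    · simp
    · exact (hpos v hv).le
  by_cases hx : (fun μ => (ξ μ).re) = 0
  · refine add_pos_of_nonneg_of_pos (hnonneg _) (hpos _ fun hy => hξ (funext fun μ => ?_))
    exact Complex.ext (congrFun hx μ) (congrFun hy μ)
  · exact add_pos_of_pos_of_nonneg (hpos _ hx) (hnonneg _)
end

section
/- Let S and T be densely defined linear operators in a complex Hilbert space 𝔥 with T ⊆ S*, i.e. D(T) ⊆ D(S*) and S* agrees with T on D(T). Suppose there exists λ ∈ ℝ such that λ − T : D(T) → 𝔥 is surjective and the range of λ − S : D(S) → 𝔥 is dense in 𝔥. Then S* = T; that is, D(S*) = D(T) and S*f = Tf for all f in this common domain. -/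
/-- A real eigenvector of `S*` is orthogonal to the range of `lam - S`, hence vanishes if this range
is dense. -/
theorem LinearPMap.eq_zero_of_adjoint_apply_eq_smul
    {H : Type*} [NormedAddCommGroup H] [InnerProductSpace ℂ H] [CompleteSpace H]
    {S : H →ₗ.[ℂ] H} (hS : Dense (S.domain : Set H)) {lam : ℝ}
    (hdense : Dense (Set.range fun x : S.domain => (lam : ℂ) • (x : H) - S x))
    {u : S.adjoint.domain} (hu : S.adjoint u = (lam : ℂ) • (u : H)) : (u : H) = 0 := by
  refine hdense.eq_zero_of_inner_left ℂ ?_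
  rintro _ ⟨x, rfl⟩
  have h := S.adjoint_isFormalAdjoint hS u x
  rw [hu, inner_smul_left, Complex.conj_ofReal] at h
  simp only [inner_sub_right, inner_smul_right, h, sub_self]

/-- Let `S`, `T` be densely defined operators in a complex Hilbert space with `T ⊆ S*`.
If for some real `λ` the operator `λ - T` is surjective and `λ - S` has dense range,
then `S* = T` (equality of domains and of the maps). -/
theorem adjoint_eq_of_restriction_surjective
    {H : Type*} [NormedAddCommGroup H] [InnerProductSpace ℂ H] [CompleteSpace H]
    (S T : H →ₗ.[ℂ] H)
    (hS : Dense (S.domain : Set H)) (hT : Dense (T.domain : Set H))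
    (hTS : T ≤ S.adjoint) (lam : ℝ)
    (hsurj : ∀ f : H, ∃ x : T.domain, (lam : ℂ) • (x : H) - T x = f)
    (hdense : Dense (Set.range fun x : S.domain => (lam : ℂ) • (x : H) - S x)) :
    S.adjoint = T := by
  refine (LinearPMap.eq_of_le_of_domain_eq hTS (le_antisymm hTS.1 fun f hf => ?_)).symm
  obtain ⟨x, hx⟩ := hsurj ((lam : ℂ) • f - S.adjoint ⟨f, hf⟩)
  let y : S.adjoint.domain := ⟨x, hTS.1 x.2⟩
  have hxy : T x = S.adjoint y := hTS.2 rfl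
  have hu : S.adjoint (⟨f, hf⟩ - y) = (lam : ℂ) • ((⟨f, hf⟩ - y : S.adjoint.domain) : H) := by
    rw [LinearPMap.map_sub, ← hxy, Submodule.coe_sub, smul_sub]
    rw [sub_eq_sub_iff_add_eq_add] at hx ⊢
    rw [add_comm, hx]
  have hfx : f - (x : H) = 0 := LinearPMap.eq_zero_of_adjoint_apply_eq_smul hS hdense hu
  rw [sub_eq_zero.mp hfx]
  exact x.2
end

section
/- Let Ω ⊆ ℝⁿ be an open set, 𝔥 a complex Hilbert space, and h : Ω → 𝔥. Then h is weakly C^∞ if and only if h is strongly C^∞. Here h is weakly C^∞ if for every φ ∈ 𝔥 the scalar function x ↦ ⟨φ, h(x)⟩ is C^∞ on Ω; and h is strongly C^∞ if all iterated directional (Gâteaux) derivatives ∂^α h, taken as limits in the norm of 𝔥 along the coordinate directions, exist at every point of Ω for every multi-index α and are norm-continuous on Ω. -/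
open scoped InnerProductSpace

noncomputable section

variable {n : ℕ} {H : Type*} [NormedAddCommGroup H] [InnerProductSpace ℂ H] [CompleteSpace H]

/-- `h : Ω → 𝔥` is weakly `C^∞`: for every `φ ∈ 𝔥` the scalar function
`x ↦ ⟨φ, h(x)⟩` is `C^∞` on `Ω`. -/
def WeaklySmooth (Ω : Set (Fin n → ℝ)) (h : (Fin n → ℝ) → H) : Prop :=
  ∀ φ : H, ContDiffOn ℝ (⊤ : ℕ∞) (fun x => (⟪φ, h x⟫_ℂ : ℂ)) Ω

/-- `h : Ω → 𝔥` is strongly `C^∞`: all iterated Gâteaux (directional) derivatives along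
coordinate directions exist throughout `Ω` as norm limits and are norm-continuous on `Ω`.
The family `F` records the iterated derivatives, indexed by the list of directions taken
(`F [] = h`, and `F (i :: l)` is the derivative of `F l` along the `i`-th direction). -/
def StronglySmooth (Ω : Set (Fin n → ℝ)) (h : (Fin n → ℝ) → H) : Prop :=
  ∃ F : List (Fin n) → (Fin n → ℝ) → H,
    F [] = h ∧
    (∀ (l : List (Fin n)) (i : Fin n), ∀ x ∈ Ω,
      HasDerivAt (fun ε : ℝ => F l (x + ε • (Pi.single i 1 : Fin n → ℝ))) (F (i :: l) x) 0) ∧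
    (∀ l : List (Fin n), ContinuousOn (F l) Ω)

section

open Filter Topology Asymptotics Metric

/-- A map with coordinate derivatives near `x` which are continuous at `x` is Fréchet
differentiable at `x`. -/
theorem hasFDerivAt_of_hasLineDerivAt_single {ι E : Type*} [Fintype ι] [DecidableEq ι]
    [NormedAddCommGroup E] [NormedSpace ℝ E]
    {f : (ι → ℝ) → E} {f' : ι → (ι → ℝ) → E} {x : ι → ℝ}
    (hf : ∀ i, ∀ᶠ y in 𝓝 x, HasLineDerivAt ℝ f (f' i y) y (Pi.single i 1))
    (hf' : ∀ i, ContinuousAt (f' i) x) :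
    HasFDerivAt f (∑ i, (ContinuousLinearMap.proj (R := ℝ) (φ := fun _ : ι => ℝ) i).smulRight
      (f' i x)) x := by
  have key : ∀ s : Finset ι, (fun u : ι → ℝ => f (x + ∑ i ∈ s, u i • Pi.single i 1) - f x -
      ∑ i ∈ s, u i • f' i x) =o[𝓝 0] (fun u => u) := by
    intro s
    induction s using Finset.induction_on with
    | empty => simp
    | insert a s ha ih =>
      have hp : Tendsto (fun p : (ι → ℝ) × ℝ =>
          x + ∑ i ∈ s, p.1 i • (Pi.single i 1 : ι → ℝ) + p.2 • (Pi.single a 1 : ι → ℝ))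
          (𝓝 0) (𝓝 x) :=
        Continuous.tendsto' (by fun_prop) _ _ (by simp)
      have hstep : (fun u : ι → ℝ => f (x + ∑ i ∈ s, u i • Pi.single i 1 + u a • Pi.single a 1) -
          f (x + ∑ i ∈ s, u i • Pi.single i 1) - u a • f' a x) =o[𝓝 0] (fun u => u) := by
        rw [isLittleO_iff]
        intro ε hε
        obtain ⟨δ, hδ, hball⟩ := Metric.eventually_nhds_iff.1 ((hp.eventually (hf a)).and
          ((hf' a).tendsto.comp hp |>.eventually (closedBall_mem_nhds _ hε)))
        filter_upwards [ball_mem_nhds 0 hδ] with u hu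
        rw [mem_ball_zero_iff] at hu
        have hua : ‖u a‖ ≤ ‖u‖ := norm_le_pi_norm u a
        have hz : ∀ τ ∈ ball (0 : ℝ) δ, dist (u, τ) 0 < δ := fun τ hτ => by
          rw [mem_ball_zero_iff] at hτ
          rw [dist_zero_right]
          exact max_lt hu hτ
        have hmvt := (convex_ball (0 : ℝ) δ).norm_image_sub_le_of_norm_hasFDerivWithin_le'
          (𝕜 := ℝ) (f := fun τ => f (x + ∑ i ∈ s, u i • Pi.single i 1 + τ • Pi.single a 1))
          (f' := fun τ => ContinuousLinearMap.toSpanSingleton ℝ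
            (f' a (x + ∑ i ∈ s, u i • Pi.single i 1 + τ • Pi.single a 1)))
          (φ := ContinuousLinearMap.toSpanSingleton ℝ (f' a x)) (C := ε) (x := 0) (y := u a)
          (fun τ hτ => by
            have h1 : HasDerivAt (fun t : ℝ => f (x + ∑ i ∈ s, u i • Pi.single i 1 +
                τ • Pi.single a 1 + t • Pi.single a 1)) (f' a (x + ∑ i ∈ s, u i • Pi.single i 1 +
                τ • Pi.single a 1)) (τ - τ) := by
              rw [sub_self]
              exact (hball (hz τ hτ)).1
            refine ((h1.comp_sub_const τ τ).congr_of_eventuallyEq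
              (Eventually.of_forall fun t => congrArg f ?_)).hasFDerivAt.hasFDerivWithinAt
            module)
          (fun τ hτ => by
            have hsub : ContinuousLinearMap.toSpanSingleton ℝ
                (f' a (x + ∑ i ∈ s, u i • Pi.single i 1 + τ • Pi.single a 1)) -
                ContinuousLinearMap.toSpanSingleton ℝ (f' a x) =
                ContinuousLinearMap.toSpanSingleton ℝ
                  (f' a (x + ∑ i ∈ s, u i • Pi.single i 1 + τ • Pi.single a 1) - f' a x) := by
              ext
              simp
            rw [hsub, ContinuousLinearMap.norm_toSpanSingleton]
            simpa [dist_eq_norm] using (hball (hz τ hτ)).2)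
          (mem_ball_self hδ) (mem_ball_zero_iff.2 (hua.trans_lt hu))
        simp only [ContinuousLinearMap.toSpanSingleton_apply, zero_smul, sub_zero,
          add_zero] at hmvt
        exact hmvt.trans (mul_le_mul_of_nonneg_left hua hε.le)
      refine (ih.add hstep).congr_left fun u => ?_
      simp only [Finset.sum_insert ha]
      rw [add_comm (u a • (Pi.single a 1 : ι → ℝ)), ← add_assoc x]
      abel
  rw [hasFDerivAt_iff_isLittleO_nhds_zero]
  refine (key Finset.univ).congr_left fun u => ?_
  have hu : ∑ i, u i • (Pi.single i 1 : ι → ℝ) = u := by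
    simpa using (pi_eq_sum_univ' u).symm
  rw [hu]
  simp

/-- On an open set, a family of maps closed under coordinate derivatives and consisting of
continuous maps consists of smooth maps. -/
theorem contDiffOn_of_hasLineDerivAt_single {ι E : Type*} [Fintype ι] [DecidableEq ι]
    [NormedAddCommGroup E] [NormedSpace ℝ E] {Ω : Set (ι → ℝ)} (hΩ : IsOpen Ω)
    {F : List ι → (ι → ℝ) → E}
    (hF : ∀ l i, ∀ x ∈ Ω, HasLineDerivAt ℝ (F l) (F (i :: l) x) x (Pi.single i 1))
    (hc : ∀ l, ContinuousOn (F l) Ω) (k : ℕ) (l : List ι) : ContDiffOn ℝ k (F l) Ω := by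
  induction k generalizing l with
  | zero => exact contDiffOn_zero.2 (hc l)
  | succ k ih =>
    rw [Nat.cast_succ, contDiffOn_succ_iff_hasFDerivWithinAt_of_uniqueDiffOn hΩ.uniqueDiffOn]
    refine ⟨by simp, fun x => ∑ i, (ContinuousLinearMap.proj (R := ℝ) (φ := fun _ : ι => ℝ)
      i).smulRight (F (i :: l) x), ContDiffOn.sum fun i _ => contDiffOn_const.smulRight (ih _),
      fun x hx => (hasFDerivAt_of_hasLineDerivAt_single (fun i => ?_) fun i =>
        (hc _).continuousAt (hΩ.mem_nhds hx)).hasFDerivWithinAt⟩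
    filter_upwards [hΩ.mem_nhds hx] with y hy using hF l i y hy

/-- The uniform boundedness principle for a family of vectors, with weights. -/
theorem exists_norm_le_mul_of_forall_norm_inner_le {ι : Type*} {u : ι → H} {w : ι → ℝ}
    (hw : ∀ i, 0 ≤ w i) (h : ∀ φ : H, ∃ C : ℝ, ∀ i, ‖⟪φ, u i⟫_ℂ‖ ≤ C * w i) :
    ∃ C : ℝ, ∀ i, ‖u i‖ ≤ C * w i := by
  obtain ⟨C, hC⟩ := banach_steinhaus (g := fun i => innerSL ℂ (((w i)⁻¹ : ℂ) • u i)) (by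
    intro φ
    obtain ⟨C, hC⟩ := h φ
    refine ⟨max C 0, fun i => ?_⟩
    rw [innerSL_apply_apply, norm_inner_symm, inner_smul_right, norm_mul, norm_inv,
      Complex.norm_real, Real.norm_of_nonneg (hw i)]
    rcases (hw i).eq_or_lt with h0 | h0
    · simp [← h0]
    · rw [inv_mul_le_iff₀ h0, mul_comm]
      exact (hC i).trans (mul_le_mul_of_nonneg_right (le_max_left _ _) h0.le))
  refine ⟨C, fun i => ?_⟩
  rcases (hw i).eq_or_lt with h0 | h0
  · obtain ⟨D, hD⟩ := h (u i)
    have h1 := hD i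
    rw [← h0, mul_zero, norm_le_zero_iff, inner_self_eq_zero] at h1
    simp [← h0, h1]
  · have h1 := hC i
    rw [innerSL_apply_norm, norm_smul, norm_inv, Complex.norm_real,
      Real.norm_of_nonneg (hw i), inv_mul_le_iff₀ h0] at h1
    rwa [mul_comm]

theorem WeaklySmooth.continuousOn {Ω : Set (Fin n → ℝ)} (hΩ : IsOpen Ω)
    {g : (Fin n → ℝ) → H} (hg : WeaklySmooth Ω g) : ContinuousOn g Ω := by
  intro x hx
  obtain ⟨r, hr, hball⟩ := nhds_basis_closedBall.mem_iff.1 (hΩ.mem_nhds hx)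
  obtain ⟨C, hC⟩ := exists_norm_le_mul_of_forall_norm_inner_le
    (u := fun y : closedBall x r => g y - g x) (w := fun y => ‖(y : Fin n → ℝ) - x‖)
    (fun _ => norm_nonneg _) (by
      intro φ
      obtain ⟨K, hK⟩ := ((hg φ).mono hball).exists_lipschitzOnWith (by simp)
        (convex_closedBall x r) (isCompact_closedBall x r)
      refine ⟨K, fun y => ?_⟩
      rw [inner_sub_right]
      exact hK.norm_sub_le y.2 (mem_closedBall_self hr.le))
  refine ContinuousAt.continuousWithinAt (tendsto_iff_norm_sub_tendsto_zero.2 ?_)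
  refine squeeze_zero' (Eventually.of_forall fun _ => norm_nonneg _)
    (g := fun y => C * ‖y - x‖) ?_ (Continuous.tendsto' (by fun_prop) _ _ (by simp))
  filter_upwards [closedBall_mem_nhds x hr] with y hy using hC ⟨y, hy⟩

theorem WeaklySmooth.exists_hasLineDerivAt {Ω : Set (Fin n → ℝ)} (hΩ : IsOpen Ω)
    {g : (Fin n → ℝ) → H} (hg : WeaklySmooth Ω g) {x : Fin n → ℝ} (hx : x ∈ Ω)
    (v : Fin n → ℝ) : ∃ g', HasLineDerivAt ℝ g g' x v := by
  simp_rw [hasLineDerivAt_iff_tendsto_slope_zero]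
  rw [← cauchy_map_iff_exists_tendsto, cauchy_map_iff']
  obtain ⟨r, hr, hball⟩ := nhds_basis_closedBall.mem_iff.1 (hΩ.mem_nhds hx)
  let T : Set ℝ := {t | t ≠ 0 ∧ ‖t • v‖ ≤ r}
  have hT : T ∈ 𝓝[≠] (0 : ℝ) := by
    refine inter_mem self_mem_nhdsWithin (mem_nhdsWithin_of_mem_nhds ?_)
    have : Tendsto (fun t : ℝ => ‖t • v‖) (𝓝 0) (𝓝 0) :=
      Continuous.tendsto' (by fun_prop) _ _ (by simp)
    exact this.eventually_le_const hr
  obtain ⟨C, hC⟩ := exists_norm_le_mul_of_forall_norm_inner_le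
    (u := fun p : T × T => (p.1 : ℝ)⁻¹ • (g (x + (p.1 : ℝ) • v) - g x) -
      (p.2 : ℝ)⁻¹ • (g (x + (p.2 : ℝ) • v) - g x))
    (w := fun p => |(p.1 : ℝ)| + |(p.2 : ℝ)|) (fun _ => by positivity) (by
      intro φ
      set f : (Fin n → ℝ) → ℂ := fun y => ⟪φ, g y⟫_ℂ with hf
      obtain ⟨hd, hd'⟩ := (contDiffOn_infty_iff_fderiv_of_isOpen hΩ).1 (hg φ)
      obtain ⟨K, hK⟩ := (hd'.mono hball).exists_lipschitzOnWith (by simp)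
        (convex_closedBall x r) (isCompact_closedBall x r)
      have hq : ∀ t ∈ T, ‖t⁻¹ • (f (x + t • v) - f x) - fderiv ℝ f x v‖ ≤
          K * ‖v‖ ^ 2 * |t| := by
        rintro t ⟨ht, htr⟩
        have hsub : closedBall x ‖t • v‖ ⊆ closedBall x r := closedBall_subset_closedBall htr
        have h1 := (convex_closedBall x ‖t • v‖).norm_image_sub_le_of_norm_fderiv_le'
          (𝕜 := ℝ) (f := f) (φ := fderiv ℝ f x) (C := K * ‖t • v‖) (x := x) (y := x + t • v)
          (fun y hy => (hd y (hball (hsub hy))).differentiableAt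
            (hΩ.mem_nhds (hball (hsub hy))))
          (fun y hy => (hK.norm_sub_le (hsub hy) (mem_closedBall_self hr.le)).trans
            (mul_le_mul_of_nonneg_left (by simpa [dist_eq_norm] using hy) K.2))
          (mem_closedBall_self (norm_nonneg _)) (by simp)
        rw [add_sub_cancel_left, map_smul] at h1
        have h2 : t⁻¹ • (f (x + t • v) - f x) - fderiv ℝ f x v =
            t⁻¹ • (f (x + t • v) - f x - t • fderiv ℝ f x v) := by
          rw [smul_sub t⁻¹ (f _ - f _), inv_smul_smul₀ ht]
        rw [h2, norm_smul, norm_inv, Real.norm_eq_abs, inv_mul_le_iff₀ (abs_pos.2 ht)]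
        refine h1.trans_eq ?_
        rw [norm_smul, Real.norm_eq_abs]
        ring
      refine ⟨K * ‖v‖ ^ 2, fun p => ?_⟩
      have h3 : ⟪φ, (p.1 : ℝ)⁻¹ • (g (x + (p.1 : ℝ) • v) - g x) -
          (p.2 : ℝ)⁻¹ • (g (x + (p.2 : ℝ) • v) - g x)⟫_ℂ =
          ((p.1 : ℝ)⁻¹ • (f (x + (p.1 : ℝ) • v) - f x) - fderiv ℝ f x v) -
          ((p.2 : ℝ)⁻¹ • (f (x + (p.2 : ℝ) • v) - f x) - fderiv ℝ f x v) := by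
        simp only [hf, inner_sub_right, inner_smul_right_eq_smul]
        abel
      rw [h3, mul_add]
      exact (norm_sub_le _ _).trans (add_le_add (hq _ p.1.2) (hq _ p.2.2)))
  rw [uniformity_eq_comap_nhds_zero, tendsto_comap_iff]
  have hw : Tendsto (fun p : ℝ × ℝ => C * (|p.2| + |p.1|)) (𝓝[≠] 0 ×ˢ 𝓝[≠] 0) (𝓝 0) := by
    refine Tendsto.mono_left ?_ (Filter.prod_mono nhdsWithin_le_nhds nhdsWithin_le_nhds)
    rw [← nhds_prod_eq]
    exact Continuous.tendsto' (by fun_prop) _ _ (by simp)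
  refine squeeze_zero_norm' ?_ hw
  filter_upwards [prod_mem_prod hT hT] with p hp
  exact hC (⟨p.2, hp.2⟩, ⟨p.1, hp.1⟩)

theorem WeaklySmooth.exists_weaklySmooth_hasLineDerivAt {Ω : Set (Fin n → ℝ)} (hΩ : IsOpen Ω)
    {g : (Fin n → ℝ) → H} (hg : WeaklySmooth Ω g) (v : Fin n → ℝ) :
    ∃ g' : (Fin n → ℝ) → H, WeaklySmooth Ω g' ∧ ∀ x ∈ Ω, HasLineDerivAt ℝ g (g' x) x v := by
  have hd : ∀ x ∈ Ω, HasLineDerivAt ℝ g (lineDeriv ℝ g x v) x v := fun x hx =>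
    have ⟨_, h⟩ := hg.exists_hasLineDerivAt hΩ hx v
    h.lineDifferentiableAt.hasLineDerivAt
  refine ⟨fun x => lineDeriv ℝ g x v, fun φ => ?_, hd⟩
  obtain ⟨hdiff, hsmooth⟩ := (contDiffOn_infty_iff_fderiv_of_isOpen hΩ).1 (hg φ)
  refine (hsmooth.clm_apply (contDiffOn_const (c := v))).congr fun x hx => ?_
  have h1 : HasLineDerivAt ℝ (fun y => ⟪φ, g y⟫_ℂ) ⟪φ, lineDeriv ℝ g x v⟫_ℂ x v :=
    ((innerSL ℂ φ).restrictScalars ℝ).hasFDerivAt.comp_hasDerivAt (0 : ℝ) (hd x hx)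
  exact h1.unique (((hdiff x hx).differentiableAt (hΩ.mem_nhds hx)).hasFDerivAt.hasLineDerivAt v)

end

/-- On an open set `Ω ⊆ ℝⁿ`, a Hilbert-space valued map is weakly `C^∞`
iff it is strongly `C^∞`. -/
theorem weaklySmooth_iff_stronglySmooth
    (Ω : Set (Fin n → ℝ)) (hΩ : IsOpen Ω) (h : (Fin n → ℝ) → H) :
    WeaklySmooth Ω h ↔ StronglySmooth Ω h := by
  constructor
  · intro hh
    choose D hD hD' using fun (g : {g : (Fin n → ℝ) → H // WeaklySmooth Ω g}) (i : Fin n) =>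
      g.2.exists_weaklySmooth_hasLineDerivAt hΩ (Pi.single i 1)
    let F : List (Fin n) → {g : (Fin n → ℝ) → H // WeaklySmooth Ω g} :=
      fun l => l.foldr (fun i g => ⟨D g i, hD g i⟩) ⟨h, hh⟩
    exact ⟨fun l => (F l).1, rfl, fun l i x hx => hD' (F l) i x hx,
      fun l => (F l).2.continuousOn hΩ⟩
  · rintro ⟨F, rfl, hF, hc⟩ φ
    have hsmooth : ContDiffOn ℝ (⊤ : ℕ∞) (F []) Ω :=
      contDiffOn_infty.2 fun k => contDiffOn_of_hasLineDerivAt_single hΩ hF hc k []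
    exact contDiffOn_const.inner ℂ hsmooth
end
end
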